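/- (Theorem TL2.) As n → ∞, the normalized final score n^{−1/2}·S_n^gr converges in distribution to 𝒮 := W + max(V_1 + 2V_2, V_2 + 2V_3, V_3 + 2V_1), and moreover all moments converge: for every positive integer k, E[(n^{−1/2} S_n^gr)^k] → E[𝒮^k]. -/

import Mathlib

open MeasureTheory ProbabilityTheory Real Filter
open scoped ENNReal Topology

namespace RPSGreedy

/-- Standard basis vector `e i` of `Fin 3 → ℕ`. -/
def e (i : Fin 3) : Fin 3 → ℕ := fun j => if j = i then 1 else 0

/-- One-step transition probabilities of the greedy game process. -/
noncomputable def stepProb (n : ℕ) (p q : (Fin 3 → ℕ) × ℤ) : ℝ≥0∞ :=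
  let k := (Finset.univ.filter fun i => p.1 i = n).card
  if k = 0 then
    (if (∃ i : Fin 3, q.1 = p.1 + e i) ∧ (q.2 = p.2 - 1 ∨ q.2 = p.2 ∨ q.2 = p.2 + 1)
      then 1/9 else 0)
  else if k = 1 then
    ∑ c : Fin 3, (if p.1 c = n then
      (if q.1 = p.1 + e (c+1) ∧ q.2 = p.2 + 1 then 2/9
       else if q.1 = p.1 + e (c+1) ∧ q.2 = p.2 - 1 then 1/9
       else if q.1 = p.1 + e (c+2) ∧ q.2 = p.2 then 4/9
       else if q.1 = p.1 + e (c+2) ∧ q.2 = p.2 + 1 then 2/9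
       else 0)
      else 0)
  else if k = 2 then
    (if ∃ i : Fin 3, p.1 i < n ∧ q.1 = p.1 + e i ∧ q.2 = p.2 + 1 then 1 else 0)
  else 0

/-- The greedy game process over `3n` rounds: initial state and Markov transitions. -/
def IsGreedyProcess (n : ℕ) {Ω : Type*} [MeasurableSpace Ω] (μ : Measure Ω)
    (NS : ℕ → Ω → (Fin 3 → ℕ) × ℤ) : Prop :=
  IsProbabilityMeasure μ ∧
  (∀ t, Measurable (NS t)) ∧
  μ {ω | NS 0 ω = (fun _ => 0, 0)} = 1 ∧
  (∀ t, t < 3 * n → ∀ f : ℕ → (Fin 3 → ℕ) × ℤ,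
    μ {ω | ∀ u ≤ t + 1, NS u ω = f u}
      = stepProb n (f t) (f (t + 1)) * μ {ω | ∀ u ≤ t, NS u ω = f u})


abbrev St := (Fin 3 → ℕ) × ℤ

/-- score increments -1, 0, 1 -/
def dl (k : Fin 3) : ℤ := (k.val : ℤ) - 1

/-- the nine possible successors of a state -/
def nx (p : St) (k : Fin 3 × Fin 3) : St := (p.1 + e k.1, p.2 + dl k.2)

/-- transition operator -/
noncomputable def K (n : ℕ) (f : St → ℝ) (p : St) : ℝ :=
  ∑ k : Fin 3 × Fin 3, (stepProb n p (nx p k)).toReal * f (nx p k)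

lemma e_inj {i j : Fin 3} (h : e i = e j) : i = j := by
  have := congrFun h i
  simp [e] at this
  exact this

lemma nx_inj (p : St) : Function.Injective (nx p) := by
  rintro ⟨i, a⟩ ⟨j, b⟩ h
  simp only [nx, Prod.mk.injEq, add_right_inj] at h
  obtain ⟨h1, h2⟩ := h
  have := e_inj h1
  simp [dl] at h2
  ext <;> simp [this] <;> omega

lemma stepProb_ne_zero {n : ℕ} {p q : St} (h : stepProb n p q ≠ 0) : ∃ k, q = nx p k := by
  have key : ∀ i : Fin 3, q.1 = p.1 + e i → (q.2 = p.2 - 1 ∨ q.2 = p.2 ∨ q.2 = p.2 + 1) →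
      ∃ k, q = nx p k := by
    rintro i hi (h | h | h)
    · exact ⟨(i, 0), Prod.ext hi (by simp [nx, dl, h]; ring)⟩
    · exact ⟨(i, 1), Prod.ext hi (by simp [nx, dl, h])⟩
    · exact ⟨(i, 2), Prod.ext hi (by simp [nx, dl, h])⟩
  simp only [stepProb] at h
  split_ifs at h with h0 h1 h2 h3 h4 h5
  · obtain ⟨⟨i, hi⟩, h⟩ := h1; exact key i hi h
  · exact absurd rfl h
  · obtain ⟨c, -, hc⟩ := Finset.exists_ne_zero_of_sum_ne_zero h
    split_ifs at hc with a1 a2 a3 a4 a5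
    · exact key _ a2.1 (by tauto)
    · exact key _ a3.1 (by tauto)
    · exact key _ a4.1 (by tauto)
    · exact key _ a5.1 (by tauto)
    all_goals exact absurd rfl hc
  · obtain ⟨i, -, hi, h⟩ := h4; exact key i hi (by tauto)
  · exact absurd rfl h
  · exact absurd rfl h

lemma stepProb_ne_top (n : ℕ) (p q : St) : stepProb n p q ≠ ⊤ := by
  have h9 : ∀ a : ℝ≥0∞, a ≠ ⊤ → a / 9 ≠ ⊤ := fun a ha => ENNReal.div_ne_top ha (by norm_num)
  simp only [stepProb]
  split_ifs
  · exact h9 _ (by simp)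
  · simp
  · refine (ENNReal.sum_lt_top.2 fun c _ => ?_).ne
    rw [lt_top_iff_ne_top]
    split_ifs <;> first | exact h9 _ (by norm_num) | simp
  all_goals simp

section proc
variable {n : ℕ} {Ω : Type*} [MeasurableSpace Ω] {μ : Measure Ω} {NS : ℕ → Ω → St}

lemma two_step (h : IsGreedyProcess n μ NS) {t : ℕ} (ht : t < 3 * n) (p q : St) :
    μ {ω | NS t ω = p ∧ NS (t+1) ω = q} = stepProb n p q * μ {ω | NS t ω = p} := by
  obtain ⟨-, hm, -, hs⟩ := h
  let path : (Fin t → St) → ℕ → St := fun g u =>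
    if hu : u < t then g ⟨u, hu⟩ else if u = t then p else q
  have hpt : ∀ g, path g t = p := fun g => by simp [path]
  have hpt1 : ∀ g, path g (t+1) = q := fun g => by simp [path]
  have hpl : ∀ g (u : Fin t), path g u = g u := fun g u => by simp [path]
  have hU0 : {ω | NS t ω = p} = ⋃ g : Fin t → St, {ω | ∀ u ≤ t, NS u ω = path g u} := by
    ext ω
    simp only [Set.mem_ofPred_eq, Set.mem_iUnion]
    constructor
    · intro hp
      refine ⟨fun u => NS u ω, fun u hu => ?_⟩
      rcases hu.lt_or_eq with h | h
      · simp [path, h]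
      · subst h; simp [path, hp]
    · rintro ⟨g, hg⟩
      rw [hg t le_rfl, hpt]
  have hU1 : {ω | NS t ω = p ∧ NS (t+1) ω = q}
      = ⋃ g : Fin t → St, {ω | ∀ u ≤ t + 1, NS u ω = path g u} := by
    ext ω
    simp only [Set.mem_ofPred_eq, Set.mem_iUnion]
    constructor
    · rintro ⟨hp, hq⟩
      refine ⟨fun u => NS u ω, fun u hu => ?_⟩
      rcases lt_trichotomy u t with h | h | h
      · simp [path, h]
      · subst h; simp [path, hp]
      · have : u = t + 1 := by omega
        subst this; simp [path, hq]
    · rintro ⟨g, hg⟩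
      rw [hg t (by omega), hg (t+1) le_rfl, hpt, hpt1]
      exact ⟨rfl, rfl⟩
  have hmeas : ∀ g s, MeasurableSet {ω | ∀ u ≤ s, NS u ω = path g u} := by
    intro g s
    have : {ω | ∀ u ≤ s, NS u ω = path g u} = ⋂ u, ⋂ (_ : u ≤ s), NS u ⁻¹' {path g u} := by
      ext ω; simp
    rw [this]
    exact MeasurableSet.iInter fun u => MeasurableSet.iInter fun _ => hm u (measurableSet_singleton _)
  have hdisj : ∀ s, t ≤ s → Pairwise (Function.onFun Disjoint
      fun g : Fin t → St => {ω | ∀ u ≤ s, NS u ω = path g u}) := by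
    intro s hts g g' hgg
    refine Set.disjoint_left.2 fun ω h1 h2 => hgg ?_
    funext u
    rw [← hpl g u, ← hpl g' u, ← h1 u (by omega), ← h2 u (by omega)]
  rw [hU0, hU1, measure_iUnion (hdisj _ (by omega)) (fun g => hmeas g _),
    measure_iUnion (hdisj _ le_rfl) (fun g => hmeas g _), ← ENNReal.tsum_mul_left]
  refine tsum_congr fun g => ?_
  have := hs t ht (path g)
  rwa [hpt, hpt1] at this

lemma lintegral_NS (h : IsGreedyProcess n μ NS) (t : ℕ) (f : St → ℝ≥0∞) :
    ∫⁻ ω, f (NS t ω) ∂μ = ∑' p, f p * μ {ω | NS t ω = p} := by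
  rw [← lintegral_map (f := f) .of_discrete (h.2.1 t), lintegral_countable']
  refine tsum_congr fun p => ?_
  rw [Measure.map_apply (h.2.1 t) (measurableSet_singleton _)]
  rfl

lemma lintegral_step (h : IsGreedyProcess n μ NS) {t : ℕ} (ht : t < 3 * n) (f : St → ℝ≥0∞) :
    ∫⁻ ω, f (NS (t+1) ω) ∂μ
      = ∫⁻ ω, (∑ k, stepProb n (NS t ω) (nx (NS t ω) k) * f (nx (NS t ω) k)) ∂μ := by
  rw [lintegral_NS h, lintegral_NS h t (fun p => ∑ k, stepProb n p (nx p k) * f (nx p k))]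
  have h1 : ∀ q, μ {ω | NS (t+1) ω = q} = ∑' p, stepProb n p q * μ {ω | NS t ω = p} := by
    intro q
    have : {ω | NS (t+1) ω = q} = ⋃ p, {ω | NS t ω = p ∧ NS (t+1) ω = q} := by
      ext ω; simp
    rw [this, measure_iUnion]
    · exact tsum_congr fun p => two_step h ht p q
    · intro p p' hpp
      exact Set.disjoint_left.2 fun ω a b => hpp (a.1.symm.trans b.1)
    · intro p
      exact (h.2.1 t (measurableSet_singleton p)).inter (h.2.1 (t+1) (measurableSet_singleton q))
  simp_rw [h1, ← ENNReal.tsum_mul_left]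
  rw [ENNReal.tsum_comm]
  refine tsum_congr fun p => ?_
  have h2 : ∀ q, f q * (stepProb n p q * μ {ω | NS t ω = p})
      = (stepProb n p q * f q) * μ {ω | NS t ω = p} := fun q => by ring
  simp_rw [h2]
  rw [ENNReal.tsum_mul_right]
  congr 1
  rw [tsum_eq_sum (s := Finset.univ.image (nx p)), Finset.sum_image (fun a _ b _ hab => nx_inj p hab)]
  intro q hq
  by_contra hne
  obtain ⟨k, hk⟩ := stepProb_ne_zero (left_ne_zero_of_mul hne)
  exact hq (by simp [hk])

lemma K_nonneg {f : St → ℝ} (hf : ∀ p, 0 ≤ f p) (p : St) : 0 ≤ K n f p :=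
  Finset.sum_nonneg fun _ _ => mul_nonneg ENNReal.toReal_nonneg (hf _)

lemma lintegral_iter (h : IsGreedyProcess n μ NS) {t : ℕ} (ht : t ≤ 3 * n) :
    ∀ (f : St → ℝ) (_ : ∀ p, 0 ≤ f p),
    ∫⁻ ω, ENNReal.ofReal (f (NS t ω)) ∂μ = ENNReal.ofReal ((K n)^[t] f (fun _ => 0, 0)) := by
  induction t with
  | zero =>
    intro f hf
    have := h.1
    have h0 : ∀ᵐ ω ∂μ, NS 0 ω = (fun _ => 0, 0) := by
      have hms : MeasurableSet {ω | NS 0 ω = (fun _ => 0, 0)} :=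
        h.2.1 0 (measurableSet_singleton _)
      exact (prob_compl_eq_zero_iff hms).2 h.2.2.1
    rw [lintegral_congr_ae (g := fun _ => ENNReal.ofReal (f (fun _ => 0, 0)))]
    · simp
    · filter_upwards [h0] with ω hω
      rw [hω]
  | succ t ih =>
    intro f hf
    rw [lintegral_step h (by omega) (fun p => ENNReal.ofReal (f p)), Function.iterate_succ_apply,
      ← ih (by omega) (K n f) (K_nonneg hf)]
    refine lintegral_congr fun ω => ?_
    rw [K, ENNReal.ofReal_sum_of_nonneg
      (fun _ _ => mul_nonneg ENNReal.toReal_nonneg (hf _))]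
    refine Finset.sum_congr rfl fun k _ => ?_
    rw [ENNReal.ofReal_mul ENNReal.toReal_nonneg, ENNReal.ofReal_toReal (stepProb_ne_top _ _ _)]

lemma iter_nonneg {f : St → ℝ} (hf : ∀ p, 0 ≤ f p) (t : ℕ) : ∀ p, 0 ≤ (K n)^[t] f p := by
  induction t with
  | zero => exact hf
  | succ t ih => intro p; rw [Function.iterate_succ_apply']; exact K_nonneg ih p

lemma integral_iter_nonneg (h : IsGreedyProcess n μ NS) {t : ℕ} (ht : t ≤ 3 * n)
    (f : St → ℝ) (hf : ∀ p, 0 ≤ f p) :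
    Integrable (fun ω => f (NS t ω)) μ ∧
    ∫ ω, f (NS t ω) ∂μ = (K n)^[t] f (fun _ => 0, 0) := by
  have hm : Measurable (fun ω => f (NS t ω)) := Measurable.comp (g := f) .of_discrete (h.2.1 t)
  constructor
  · refine ⟨hm.aestronglyMeasurable, ?_⟩
    rw [hasFiniteIntegral_iff_ofReal (ae_of_all _ fun ω => hf _), lintegral_iter h ht f hf]
    exact ENNReal.ofReal_lt_top
  · rw [integral_eq_lintegral_of_nonneg_ae (ae_of_all _ fun ω => hf _) hm.aestronglyMeasurable,
      lintegral_iter h ht f hf, ENNReal.toReal_ofReal (iter_nonneg hf _ _)]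

lemma iter_sub (f g : St → ℝ) (t : ℕ) :
    (K n)^[t] (fun p => f p - g p) = fun p => (K n)^[t] f p - (K n)^[t] g p := by
  induction t with
  | zero => rfl
  | succ t ih =>
    rw [Function.iterate_succ_apply', ih]
    funext p
    simp only [Function.iterate_succ_apply', K, mul_sub, Finset.sum_sub_distrib]

lemma integral_iter (h : IsGreedyProcess n μ NS) {t : ℕ} (ht : t ≤ 3 * n) (f : St → ℝ) :
    Integrable (fun ω => f (NS t ω)) μ ∧
    ∫ ω, f (NS t ω) ∂μ = (K n)^[t] f (fun _ => 0, 0) := by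
  have h1 := integral_iter_nonneg h ht (fun p => max (f p) 0) (fun p => le_max_right _ _)
  have h2 := integral_iter_nonneg h ht (fun p => max (-f p) 0) (fun p => le_max_right _ _)
  have hf : f = fun p => max (f p) 0 - max (-f p) 0 := by
    funext p
    rcases le_total (f p) 0 with h | h
    · rw [max_eq_right h, max_eq_left (by linarith)]; ring
    · rw [max_eq_left h, max_eq_right (by linarith)]; ring
  rw [hf]
  refine ⟨h1.1.sub h2.1, ?_⟩
  rw [integral_sub h1.1 h2.1, h1.2, h2.2, iter_sub]

end proc

/-- free-walk operator -/
noncomputable def Q (f : St → ℝ) (p : St) : ℝ := (1/9) * ∑ k : Fin 3 × Fin 3, f (nx p k)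

lemma e_eq_iff {i j : Fin 3} : e i = e j ↔ i = j := ⟨e_inj, fun h => h ▸ rfl⟩

lemma K_interior {n : ℕ} {p : St} (hp : ∀ i, p.1 i ≠ n) (f : St → ℝ) : K n f p = Q f p := by
  have hk : (Finset.univ.filter fun i => p.1 i = n).card = 0 := by
    simp [hp]
  have hs : ∀ k, (stepProb n p (nx p k)).toReal = 1/9 := by
    intro k
    have : stepProb n p (nx p k) = 1/9 := by
      simp only [stepProb, hk, if_true]
      rw [if_pos]
      refine ⟨⟨k.1, rfl⟩, ?_⟩
      obtain ⟨i, j⟩ := k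
      fin_cases j <;> simp [nx, dl]
      ring
    rw [this]; simp
  simp only [K, Q, hs, Finset.mul_sum]

lemma sum9 (c : Fin 3) (g : Fin 3 × Fin 3 → ℝ) : ∑ k, g k =
    (g (c, 0) + g (c, 1) + g (c, 2)) + (g (c+1, 0) + g (c+1, 1) + g (c+1, 2))
    + (g (c+2, 0) + g (c+2, 1) + g (c+2, 2)) := by
  rw [Fintype.sum_prod_type]
  simp only [Fin.sum_univ_three]
  fin_cases c <;> simp <;> ring

lemma fin3_cases (c i : Fin 3) : i = c ∨ i = c + 1 ∨ i = c + 2 := by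
  revert c i; decide

lemma K_side {n : ℕ} {p : St} {c : Fin 3} (h0 : p.1 c = n) (h1 : p.1 (c+1) ≠ n)
    (h2 : p.1 (c+2) ≠ n) (f : St → ℝ) : K n f p =
      2/9 * f (nx p (c+1, 2)) + 1/9 * f (nx p (c+1, 0)) + 4/9 * f (nx p (c+2, 1))
      + 2/9 * f (nx p (c+2, 2)) := by
  have hiff : ∀ i, p.1 i = n ↔ i = c := by
    intro i
    refine ⟨fun h => ?_, fun h => h ▸ h0⟩
    rcases fin3_cases c i with rfl | rfl | rfl
    · rfl
    · exact absurd h h1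
    · exact absurd h h2
  have hk : (Finset.univ.filter fun i => p.1 i = n).card = 1 := by
    simp [hiff, Finset.filter_eq']
  have c1 : c ≠ c + 1 := by clear * -; revert c; decide
  have c2 : c ≠ c + 2 := by clear * -; revert c; decide
  have c3 : c + 1 ≠ c + 2 := by clear * -; revert c; decide
  have hs : ∀ q, stepProb n p q = (if q.1 = p.1 + e (c+1) ∧ q.2 = p.2 + 1 then 2/9
       else if q.1 = p.1 + e (c+1) ∧ q.2 = p.2 - 1 then 1/9
       else if q.1 = p.1 + e (c+2) ∧ q.2 = p.2 then 4/9
       else if q.1 = p.1 + e (c+2) ∧ q.2 = p.2 + 1 then 2/9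
       else 0) := by
    intro q
    simp only [stepProb, hk]
    simp [hiff]
  have a0 : ∀ x : ℤ, ¬ (x = x + 1) := by intro x; omega
  have a1 : ∀ x : ℤ, ¬ (x = x - 1) := by intro x; omega
  have a2 : ∀ x : ℤ, ¬ (x + 1 = x - 1) := by intro x; omega
  have a3 : ∀ x : ℤ, ¬ (x - 1 = x + 1) := by intro x; omega
  have a4 : ∀ x : ℤ, ¬ (x + 1 = x) := by intro x; omega
  have a5 : ∀ x : ℤ, ¬ (x - 1 = x) := by intro x; omega
  have d0 : dl 0 = -1 := rfl
  have d1 : dl 1 = 0 := rfl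
  have d2 : dl 2 = 1 := rfl
  rw [K, sum9 c]
  simp only [hs]
  simp [nx, e_eq_iff, c1, c2, c3, c3.symm, d0, d1, d2, a1, a2, a3, ← sub_eq_add_neg]
  ring

lemma K_two {n : ℕ} {p : St} {c : Fin 3} (h0 : p.1 c < n) (h1 : p.1 (c+1) = n)
    (h2 : p.1 (c+2) = n) (f : St → ℝ) : K n f p = f (nx p (c, 2)) := by
  have hiff : ∀ i, p.1 i = n ↔ i ≠ c := by
    intro i
    rcases fin3_cases c i with rfl | rfl | rfl
    · simp [h0.ne]
    · simp [h1]
    · simp [h2]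
  have hlt : ∀ i, p.1 i < n ↔ i = c := by
    intro i
    rcases fin3_cases c i with rfl | rfl | rfl
    · simp [h0]
    · simp [h1]
    · simp [h2]
  have hk : (Finset.univ.filter fun i => p.1 i = n).card = 2 := by
    simp [hiff, Finset.filter_ne']
  have c1 : c ≠ c + 1 := by clear * -; revert c; decide
  have c2 : c ≠ c + 2 := by clear * -; revert c; decide
  have c3 : c + 1 ≠ c + 2 := by clear * -; revert c; decide
  have hs : ∀ q, stepProb n p q = (if q.1 = p.1 + e c ∧ q.2 = p.2 + 1 then 1 else 0) := by
    intro q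
    simp only [stepProb, hk, hlt]
    simp
  have d0 : dl 0 = -1 := rfl
  have d1 : dl 1 = 0 := rfl
  have d2 : dl 2 = 1 := rfl
  rw [K, sum9 c]
  simp only [hs]
  simp [nx, e_eq_iff, c1, c2, c3, c3.symm, c1.symm, d0, d1, d2]


/-- reachable states with `j` remaining steps -/
def R (n j : ℕ) (p : St) : Prop := (∀ i, p.1 i ≤ n) ∧ p.1 0 + p.1 1 + p.1 2 + j = 3 * n

lemma sum_cyc (c : Fin 3) (g : Fin 3 → ℕ) : g 0 + g 1 + g 2 = g c + g (c+1) + g (c+2) := by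
  fin_cases c <;> simp <;> ring

lemma R.sum {n j : ℕ} {p : St} (h : R n j p) (c : Fin 3) :
    p.1 c + p.1 (c+1) + p.1 (c+2) + j = 3 * n := by
  rw [← sum_cyc]; exact h.2

lemma nx_fst (p : St) (i k j : Fin 3) : (nx p (i, k)).1 j = p.1 j + if j = i then 1 else 0 := by
  simp [nx, e]

lemma nx_snd (p : St) (i k : Fin 3) : (nx p (i, k)).2 = p.2 + dl k := rfl

lemma R.next {n j : ℕ} {p : St} (h : R n (j+1) p) {i : Fin 3} (hi : p.1 i ≠ n) (k : Fin 3) :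
    R n j (nx p (i, k)) := by
  constructor
  · intro l
    rw [nx_fst]
    have := h.1 l
    split_ifs with hl
    · subst hl; omega
    · omega
  · have := h.2
    simp only [nx_fst]
    fin_cases i <;> simp <;> omega

lemma R.succ_of_lt {n j : ℕ} {p : St} (h : R n j p) {c : Fin 3} (hc : p.1 c ≠ n) :
    ∃ j', j = j' + 1 := by
  have h1 := h.1 c
  have h2 := h.1 (c+1)
  have h3 := h.1 (c+2)
  have := h.sum c
  exact ⟨j - 1, by omega⟩

lemma phase3 {n : ℕ} (φ : ℝ → ℝ) (c : Fin 3) (j : ℕ) : ∀ p : St, R n j p → p.1 (c+1) = n →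
    p.1 (c+2) = n → (K n)^[j] (fun q => φ q.2) p = φ (p.2 + j) := by
  have c1 : c + 1 ≠ c := by clear * -; revert c; decide
  have c2 : c + 2 ≠ c := by clear * -; revert c; decide
  induction j with
  | zero => intro p _ _ _; simp
  | succ j ih =>
    intro p hp h1 h2
    have h := hp.sum c
    have hl := hp.1 c
    have hc : p.1 c < n := by omega
    rw [Function.iterate_succ_apply', K_two hc h1 h2, ih _ (hp.next hc.ne 2)
      (by rw [nx_fst]; simp [c1, h1]) (by rw [nx_fst]; simp [c2, h2])]
    congr 1
    rw [nx_snd]; simp [dl]; ring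

lemma am_gm {ε : ℝ} (hε : 0 < ε) {d H : ℝ} (h : d ^ 2 ≤ H) : |d| ≤ ε / 2 + H / (2 * ε) := by
  have h1 : ε / 2 + H / (2 * ε) = (ε ^ 2 + H) / (2 * ε) := by field_simp
  rw [h1, le_div_iff₀ (by positivity)]
  nlinarith [sq_nonneg (|d| - ε), sq_abs d]

/-- martingale `S + B/2` -/
noncomputable def Mm (n : ℕ) (c : Fin 3) (p : St) : ℝ := p.2 + ((n : ℝ) - p.1 (c+2)) / 2
/-- martingale `B - 2A` -/
noncomputable def Yy (n : ℕ) (c : Fin 3) (p : St) : ℝ :=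
  ((n : ℝ) - p.1 (c+2)) - 2 * ((n : ℝ) - p.1 (c+1))

lemma side {n : ℕ} {φ : ℝ → ℝ} {L ε : ℝ} (hL : 0 ≤ L) (hφ : ∀ x y, |φ x - φ y| ≤ L * |x - y|)
    (hε : 0 < ε) (c : Fin 3) (m0 y0 : ℝ) (j : ℕ) : ∀ p : St, R n j p → p.1 c = n →
    |(K n)^[j] (fun q => φ q.2) p - φ (m0 + |y0| / 2)|
      ≤ L * (ε / 2 + (2 * (Mm n c p - m0) ^ 2 + (Yy n c p - y0) ^ 2 / 2 + 2 * j) / (2 * ε)) := by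
  have c1 : c ≠ c + 1 := by clear * -; revert c; decide
  have c2 : c ≠ c + 2 := by clear * -; revert c; decide
  have c3 : c + 1 ≠ c + 2 := by clear * -; revert c; decide
  have base : ∀ (j : ℕ) (p : St), (p.2 + j : ℝ) = Mm n c p + |Yy n c p| / 2 →
      |φ (p.2 + j) - φ (m0 + |y0| / 2)|
      ≤ L * (ε / 2 + (2 * (Mm n c p - m0) ^ 2 + (Yy n c p - y0) ^ 2 / 2 + 2 * j) / (2 * ε)) := by
    intro j p h
    refine (hφ _ _).trans (mul_le_mul_of_nonneg_left (am_gm hε ?_) hL)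
    rw [h]
    have h1 := abs_abs_sub_abs_le (Yy n c p) y0
    have h2 : (|Yy n c p| - |y0|) ^ 2 ≤ (Yy n c p - y0) ^ 2 := sq_le_sq.2 h1
    have h3 : (0 : ℝ) ≤ j := Nat.cast_nonneg j
    nlinarith [sq_nonneg ((Mm n c p - m0) - (|Yy n c p| - |y0|) / 2)]
  induction j with
  | zero =>
    intro p hp h0
    have := hp.sum c
    have h1 := hp.1 (c+1)
    have h2 := hp.1 (c+2)
    have e1 : p.1 (c+1) = n := by omega
    have e2 : p.1 (c+2) = n := by omega
    have := base 0 p (by simp [Mm, Yy, e1, e2])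
    simpa using this
  | succ j ih =>
    intro p hp h0
    have hs := hp.sum c
    by_cases h1 : p.1 (c+1) = n
    · have e1 : c + 2 + 1 = c := by clear * -; revert c; decide
      have e2 : c + 2 + 2 = c + 1 := by clear * -; revert c; decide
      rw [phase3 φ (c+2) (j+1) p hp (by rw [e1, h0]) (by rw [e2, h1])]
      apply base
      have : (n : ℝ) - p.1 (c+2) = (j + 1 : ℕ) := by
        have : p.1 (c+2) + (j + 1) = n := by omega
        rw [← this]; push_cast; ring
      simp only [Mm, Yy, h1, this]
      rw [sub_self, mul_zero, sub_zero, abs_of_nonneg (Nat.cast_nonneg _)]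
      ring
    by_cases h2 : p.1 (c+2) = n
    · have e1 : c + 1 + 1 = c + 2 := by clear * -; revert c; decide
      have e2 : c + 1 + 2 = c := by clear * -; revert c; decide
      rw [phase3 φ (c+1) (j+1) p hp (by rw [e1, h2]) (by rw [e2, h0])]
      apply base
      have : (n : ℝ) - p.1 (c+1) = (j + 1 : ℕ) := by
        have : p.1 (c+1) + (j + 1) = n := by omega
        rw [← this]; push_cast; ring
      simp only [Mm, Yy, h2, this]
      rw [sub_self, zero_sub, abs_neg, abs_of_nonneg (by positivity)]
      ring
    rw [Function.iterate_succ_apply', K_side h0 h1 h2]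
    have i1 := ih _ (hp.next h1 2) (by rw [nx_fst]; simp [c1, h0])
    have i2 := ih _ (hp.next h1 0) (by rw [nx_fst]; simp [c1, h0])
    have i3 := ih _ (hp.next h2 1) (by rw [nx_fst]; simp [c2, h0])
    have i4 := ih _ (hp.next h2 2) (by rw [nx_fst]; simp [c2, h0])
    have M1 : Mm n c (nx p (c+1, 2)) = Mm n c p + 1 := by
      simp [Mm, nx_fst, nx_snd, dl, c3.symm]; ring
    have M2 : Mm n c (nx p (c+1, 0)) = Mm n c p - 1 := by
      simp [Mm, nx_fst, nx_snd, dl, c3.symm]; ring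
    have M3 : Mm n c (nx p (c+2, 1)) = Mm n c p - 1/2 := by
      simp [Mm, nx_fst, nx_snd, dl]; ring
    have M4 : Mm n c (nx p (c+2, 2)) = Mm n c p + 1/2 := by
      simp [Mm, nx_fst, nx_snd, dl]; ring
    have Y1 : ∀ k, Yy n c (nx p (c+1, k)) = Yy n c p + 2 := by
      intro k; simp [Yy, nx_fst, c3.symm]; ring
    have Y2 : ∀ k, Yy n c (nx p (c+2, k)) = Yy n c p - 1 := by
      intro k; simp [Yy, nx_fst, c3]; ring
    rw [M1, Y1] at i1
    rw [M2, Y1] at i2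
    rw [M3, Y2] at i3
    rw [M4, Y2] at i4
    generalize Mm n c p = M at *
    generalize Yy n c p = Y at *
    set a := φ (m0 + |y0| / 2)
    have hid : L * (ε / 2 + (2 * (M - m0) ^ 2 + (Y - y0) ^ 2 / 2 + 2 * ((j + 1 : ℕ) : ℝ)) / (2 * ε))
      = 2/9 * (L * (ε / 2 + (2 * (M + 1 - m0) ^ 2 + (Y + 2 - y0) ^ 2 / 2 + 2 * (j : ℝ)) / (2 * ε)))
      + 1/9 * (L * (ε / 2 + (2 * (M - 1 - m0) ^ 2 + (Y + 2 - y0) ^ 2 / 2 + 2 * (j : ℝ)) / (2 * ε)))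
      + 4/9 * (L * (ε / 2 + (2 * (M - 1/2 - m0) ^ 2 + (Y - 1 - y0) ^ 2 / 2 + 2 * (j : ℝ)) / (2 * ε)))
      + 2/9 * (L * (ε / 2 + (2 * (M + 1/2 - m0) ^ 2 + (Y - 1 - y0) ^ 2 / 2 + 2 * (j : ℝ)) / (2 * ε)))
      := by
      push_cast; field_simp; ring
    rw [hid]
    rw [abs_le] at *
    constructor <;> linarith [i1.1, i2.1, i3.1, i4.1, i1.2, i2.2, i3.2, i4.2]

/-- limiting functional -/
noncomputable def F (p : St) : ℝ :=
  max ((p.1 0 : ℝ) - p.1 1) (max ((p.1 1 : ℝ) - p.1 2) ((p.1 2 : ℝ) - p.1 0))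

lemma F_cyc (c : Fin 3) (p : St) : F p =
    max ((p.1 c : ℝ) - p.1 (c+1)) (max ((p.1 (c+1) : ℝ) - p.1 (c+2)) ((p.1 (c+2) : ℝ) - p.1 c)) := by
  have : ∀ a b c : ℝ, max a (max b c) = max b (max c a) := by
    intro a b c; rw [max_comm a, max_assoc]
  fin_cases c
  · rfl
  · simp [F]; rw [this]
  · simp [F]; rw [this, this]

lemma F_side {n j : ℕ} {p : St} (hp : R n j p) {c : Fin 3} (hc : p.1 c = n) :
    (p.2 : ℝ) + F p = Mm n c p + |Yy n c p| / 2 := by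
  have h1 : (p.1 (c+1) : ℝ) ≤ n := by exact_mod_cast hp.1 (c+1)
  have h2 : (p.1 (c+2) : ℝ) ≤ n := by exact_mod_cast hp.1 (c+2)
  rw [F_cyc c, hc, Mm, Yy]
  generalize (p.1 (c+1) : ℝ) = a at *
  generalize (p.1 (c+2) : ℝ) = b at *
  rcases le_total 0 ((n : ℝ) - b - 2 * (n - a)) with h | h
  · rw [abs_of_nonneg h, max_eq_left (a := a - b) (by linarith), max_eq_right (by linarith)]; ring
  · rw [abs_of_nonpos h, max_eq_left]
    · ring
    · exact max_le (by linarith) (by linarith)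

lemma side' {n : ℕ} {φ : ℝ → ℝ} {L ε : ℝ} (hL : 0 ≤ L) (hφ : ∀ x y, |φ x - φ y| ≤ L * |x - y|)
    (hε : 0 < ε) {c : Fin 3} {j : ℕ} {p : St} (hp : R n j p) (hc : p.1 c = n) :
    |(K n)^[j] (fun q => φ q.2) p - φ (p.2 + F p)| ≤ L * (ε / 2 + j / ε) := by
  have := side hL hφ hε c (Mm n c p) (Yy n c p) j p hp hc
  rw [← F_side hp hc] at this
  refine this.trans (le_of_eq ?_)
  field_simp
  ring

lemma Q_sub_le {f g h : St → ℝ} {p : St} (H : ∀ k, |f (nx p k) - g (nx p k)| ≤ h (nx p k)) :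
    |Q f p - Q g p| ≤ Q h p := by
  rw [Q, Q, Q, ← mul_sub, ← Finset.sum_sub_distrib, abs_mul, abs_of_pos (by norm_num)]
  refine mul_le_mul_of_nonneg_left ?_ (by norm_num)
  exact (Finset.abs_sum_le_sum_abs _ _).trans (Finset.sum_le_sum fun k _ => H k)

lemma Q_const (a : ℝ) (p : St) : Q (fun _ => a) p = a := by
  simp [Q]

/-- quadratic reference function -/
noncomputable def Hq (p0 p : St) : ℝ := 2 * ((p.2 : ℝ) - p0.2) ^ 2 +
  2 * ((((p.1 0 : ℝ) - p.1 1) - (p0.1 0 - p0.1 1)) ^ 2 + (((p.1 1 : ℝ) - p.1 2) - (p0.1 1 - p0.1 2)) ^ 2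
    + (((p.1 2 : ℝ) - p.1 0) - (p0.1 2 - p0.1 0)) ^ 2)

lemma Q_Hq (p0 p : St) (a b : ℝ) :
    Q (fun q => a + b * Hq p0 q) p = a + b * (Hq p0 p + 16/3) := by
  rw [Q, sum9 0]
  simp [Hq, nx_fst, nx_snd, dl]
  ring

lemma F_sub_sq (p0 p : St) : ((p.2 + F p) - (p0.2 + F p0)) ^ 2 ≤ Hq p0 p := by
  have h : |F p - F p0| ≤ max |((p.1 0 : ℝ) - p.1 1) - (p0.1 0 - p0.1 1)|
      (max |((p.1 1 : ℝ) - p.1 2) - (p0.1 1 - p0.1 2)|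
        |((p.1 2 : ℝ) - p.1 0) - (p0.1 2 - p0.1 0)|) :=
    (abs_max_sub_max_le_max _ _ _ _).trans (max_le_max le_rfl (abs_max_sub_max_le_max _ _ _ _))
  rw [Hq]
  generalize ((p.1 0 : ℝ) - p.1 1) - (p0.1 0 - p0.1 1) = x at *
  generalize ((p.1 1 : ℝ) - p.1 2) - (p0.1 1 - p0.1 2) = y at *
  generalize ((p.1 2 : ℝ) - p.1 0) - (p0.1 2 - p0.1 0) = z at *
  have h2 : (F p - F p0) ^ 2 ≤ x ^ 2 + y ^ 2 + z ^ 2 := by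
    rw [← sq_abs]
    rcases le_max_iff.1 h with h | h
    · nlinarith [pow_le_pow_left₀ (abs_nonneg (F p - F p0)) h 2, sq_abs x, sq_nonneg y, sq_nonneg z]
    rcases le_max_iff.1 h with h | h
    · nlinarith [pow_le_pow_left₀ (abs_nonneg (F p - F p0)) h 2, sq_abs y, sq_nonneg x, sq_nonneg z]
    · nlinarith [pow_le_pow_left₀ (abs_nonneg (F p - F p0)) h 2, sq_abs z, sq_nonneg y, sq_nonneg x]
  nlinarith [sq_nonneg (((p.2 : ℝ) - p0.2) - (F p - F p0))]

lemma free_bound {φ : ℝ → ℝ} {L ε : ℝ} (hL : 0 ≤ L) (hφ : ∀ x y, |φ x - φ y| ≤ L * |x - y|)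
    (hε : 0 < ε) (p0 : St) (j : ℕ) : ∀ p : St,
    |Q^[j] (fun q => φ (q.2 + F q)) p - φ (p0.2 + F p0)|
      ≤ L * (ε / 2 + (Hq p0 p + 16/3 * j) / (2 * ε)) := by
  induction j with
  | zero =>
    intro p
    refine (hφ _ _).trans (mul_le_mul_of_nonneg_left (am_gm hε ?_) hL)
    simpa using F_sub_sq p0 p
  | succ j ih =>
    intro p
    rw [Function.iterate_succ_apply']
    have := Q_sub_le (p := p) (f := Q^[j] (fun q => φ (q.2 + F q)))
      (g := fun _ => φ (p0.2 + F p0))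
      (h := fun q => L * (ε / 2 + (Hq p0 q + 16/3 * (j : ℝ)) / (2 * ε))) (fun k => ih (nx p k))
    rw [Q_const] at this
    refine this.trans (le_of_eq ?_)
    have h2 : (fun q => L * (ε / 2 + (Hq p0 q + 16/3 * (j : ℝ)) / (2 * ε)))
      = fun q => L * (ε / 2 + (16/3 * (j : ℝ)) / (2 * ε)) + L / (2 * ε) * Hq p0 q := by
      funext q; ring
    rw [h2, Q_Hq]
    push_cast; ring

lemma free_bound' {φ : ℝ → ℝ} {L ε : ℝ} (hL : 0 ≤ L) (hφ : ∀ x y, |φ x - φ y| ≤ L * |x - y|)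
    (hε : 0 < ε) (j : ℕ) (p : St) :
    |Q^[j] (fun q => φ (q.2 + F q)) p - φ (p.2 + F p)| ≤ L * (ε / 2 + 8/3 * j / ε) := by
  refine (free_bound hL hφ hε p j p).trans (le_of_eq ?_)
  simp only [Hq, sub_self]
  field_simp
  ring

/-- centered coordinate -/
noncomputable def xc (i : Fin 3) (p : St) : ℝ := p.1 i - ((p.1 0 : ℝ) + p.1 1 + p.1 2) / 3

noncomputable def Dd (p : St) : ℝ := xc 0 p ^ 2 + xc 1 p ^ 2 + xc 2 p ^ 2

lemma Q_Dd (p : St) (a b : ℝ) : Q (fun q => a + b * Dd q) p = a + b * (Dd p + 2/3) := by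
  rw [Q, sum9 0]
  simp [Dd, xc, nx_fst]
  ring

lemma xc_bdry {n j : ℕ} {p : St} (hp : R n j p) {c : Fin 3} (hc : p.1 c = n) :
    3 * xc c p = j := by
  have := hp.2
  have h2 : ((p.1 0 : ℝ) + p.1 1 + p.1 2) + j = 3 * n := by exact_mod_cast this
  rw [xc, hc]; linarith

lemma compare {n : ℕ} {φ : ℝ → ℝ} {L ε s : ℝ} (hL : 0 ≤ L)
    (hφ : ∀ x y, |φ x - φ y| ≤ L * |x - y|) (hε : 0 < ε) (hs : 0 < s) (j : ℕ) : ∀ p, R n j p →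
    |(K n)^[j] (fun q => φ q.2) p - Q^[j] (fun q => φ (q.2 + F q)) p|
      ≤ L * (ε + (11/3) / ε * ((s + (9 * Dd p + 6 * j) / s) / 2)) := by
  have bdry : ∀ (j : ℕ) p, R n j p → ∀ c, p.1 c = n →
    |(K n)^[j] (fun q => φ q.2) p - Q^[j] (fun q => φ (q.2 + F q)) p|
      ≤ L * (ε + (11/3) / ε * ((s + (9 * Dd p + 6 * j) / s) / 2)) := by
    intro j p hp c hc
    have h1 := side' hL hφ hε hp hc
    have h2 := free_bound' hL hφ hε j p
    have h3 := abs_sub_le ((K n)^[j] (fun q => φ q.2) p) (φ (p.2 + F p))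
      (Q^[j] (fun q => φ (q.2 + F q)) p)
    rw [abs_sub_comm (φ (p.2 + F p))] at h3
    have hj0 : (0 : ℝ) ≤ j := Nat.cast_nonneg j
    have hj : (j : ℝ) ≤ (s + (9 * Dd p + 6 * j) / s) / 2 := by
      have hD : (j : ℝ) ^ 2 ≤ 9 * Dd p := by
        rw [← xc_bdry hp hc, Dd]
        rcases fin3_cases 0 c with rfl | rfl | rfl <;> try simp only [zero_add]
        all_goals
          nlinarith [sq_nonneg (xc 0 p), sq_nonneg (xc 1 p), sq_nonneg (xc 2 p)]
      have : (s + (9 * Dd p + 6 * j) / s) / 2 = (s ^ 2 + (9 * Dd p + 6 * j)) / (2 * s) := by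
        field_simp
      rw [this, le_div_iff₀ (by positivity)]
      nlinarith [sq_nonneg ((j : ℝ) - s)]
    have h4 : L * (ε / 2 + j / ε) + L * (ε / 2 + 8/3 * j / ε) = L * (ε + (11/3) / ε * j) := by
      field_simp; ring
    have h5 : L * (ε + (11/3) / ε * j)
        ≤ L * (ε + (11/3) / ε * ((s + (9 * Dd p + 6 * j) / s) / 2)) := by gcongr
    linarith
  induction j with
  | zero =>
    intro p hp
    refine bdry 0 p hp 0 ?_
    have := hp.2
    have h0 := hp.1 0
    have h1 := hp.1 1
    have h2 := hp.1 2
    omega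
  | succ j ih =>
    intro p hp
    by_cases h : ∃ c, p.1 c = n
    · obtain ⟨c, hc⟩ := h
      exact bdry _ p hp c hc
    push Not at h
    rw [Function.iterate_succ_apply', Function.iterate_succ_apply', K_interior h]
    refine (Q_sub_le (h := fun p => L * (ε + (11/3) / ε * ((s + (9 * Dd p + 6 * j) / s) / 2)))
      (fun k => ih _ (hp.next (h k.1) k.2))).trans (le_of_eq ?_)
    have h2 : (fun p => L * (ε + (11/3) / ε * ((s + (9 * Dd p + 6 * j) / s) / 2)))
      = fun p => L * (ε + (11/3) / ε * ((s + (6 * (j : ℝ)) / s) / 2))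
        + L * ((11/3) / ε * (9 / s / 2)) * Dd p := by
      funext q; ring
    rw [h2, Q_Dd]
    push_cast; ring

/-- exponential bounds -/
lemma exp_crude {n : ℕ} {θ : ℝ} (hθ : 0 ≤ θ) (j : ℕ) : ∀ p, R n j p →
    (K n)^[j] (fun q => exp (θ * |(q.2 : ℝ)|)) p ≤ exp (θ * (|(p.2 : ℝ)| + j)) := by
  have step : ∀ (p : St) (i k : Fin 3), |((nx p (i, k)).2 : ℝ)| ≤ |(p.2 : ℝ)| + 1 := by
    intro p i k
    rw [nx_snd, Int.cast_add]
    refine (abs_add_le _ _).trans ?_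
    gcongr
    fin_cases k <;> simp [dl]
  induction j with
  | zero => intro p _; simp
  | succ j ih =>
    intro p hp
    rw [Function.iterate_succ_apply']
    set f := (K n)^[j] (fun q => exp (θ * |(q.2 : ℝ)|))
    have key : ∀ i k, p.1 i ≠ n → f (nx p (i, k)) ≤ exp (θ * (|(p.2 : ℝ)| + (j + 1 : ℕ))) := by
      intro i k hi
      refine (ih _ (hp.next hi k)).trans (exp_le_exp.2 (mul_le_mul_of_nonneg_left ?_ hθ))
      have := step p i k
      push_cast
      linarith
    by_cases h : ∃ c, p.1 c = n
    · obtain ⟨c, hc⟩ := h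
      have hs := hp.sum c
      by_cases h1 : p.1 (c+1) = n
      · have e1 : c + 2 + 1 = c := by clear * -; revert c; decide
        have e2 : c + 2 + 2 = c + 1 := by clear * -; revert c; decide
        have h2 : p.1 (c+2) < n := by omega
        rw [K_two h2 (by rw [e1, hc]) (by rw [e2, h1])]
        exact key _ _ h2.ne
      by_cases h2 : p.1 (c+2) = n
      · have e1 : c + 1 + 1 = c + 2 := by clear * -; revert c; decide
        have e2 : c + 1 + 2 = c := by clear * -; revert c; decide
        have h1' : p.1 (c+1) < n := by omega
        rw [K_two h1' (by rw [e1, h2]) (by rw [e2, hc])]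
        exact key _ _ h1
      rw [K_side hc h1 h2]
      linarith [key (c+1) 2 h1, key (c+1) 0 h1, key (c+2) 1 h2, key (c+2) 2 h2]
    · push Not at h
      rw [K_interior h, Q, sum9 0]
      linarith [key 0 0 (h _), key 0 1 (h _), key 0 2 (h _), key (0+1) 0 (h _), key (0+1) 1 (h _),
        key (0+1) 2 (h _), key (0+2) 0 (h _), key (0+2) 1 (h _), key (0+2) 2 (h _)]

lemma exp_quad {x : ℝ} (h : |x| ≤ 1) : exp x ≤ 1 + x + x ^ 2 := by
  have := (abs_le.1 (Real.abs_exp_sub_one_sub_id_le h)).2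
  linarith

lemma Q_exp {θ : ℝ} (h0 : 0 ≤ θ) (h1 : θ ≤ 1/2) (σ : ℝ) (hσ : σ = 1 ∨ σ = -1) (i : Fin 3) (p : St) :
    Q (fun q => exp (θ * (σ * q.2 + 3 * xc i q))) p
      ≤ exp (θ * (σ * p.2 + 3 * xc i p)) * exp (3 * θ ^ 2) := by
  have hx : ∀ (i' k : Fin 3), exp (θ * (σ * (nx p (i', k)).2 + 3 * xc i (nx p (i', k))))
      = exp (θ * (σ * p.2 + 3 * xc i p)) *
        (exp (θ * (σ * dl k)) * (if i' = i then exp (2 * θ) else exp (-θ))) := by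
    intro i' k
    have : xc i (nx p (i', k)) = xc i p + (if i' = i then (2/3 : ℝ) else -1/3) := by
      simp only [xc, nx_fst]
      fin_cases i <;> fin_cases i' <;> simp <;> ring
    rw [this, nx_snd]
    split_ifs <;> rw [← exp_add, ← exp_add] <;> congr 1 <;> push_cast <;> ring
  have e1 := exp_quad (x := θ) (by rw [abs_of_nonneg h0]; linarith)
  have e2 := exp_quad (x := -θ) (by rw [abs_neg, abs_of_nonneg h0]; linarith)
  have e3 := exp_quad (x := 2 * θ) (by rw [abs_of_nonneg (by linarith)]; linarith)
  rw [Q, sum9 i]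
  have n1 : i + 1 ≠ i := by clear * -; revert i; decide
  have n2 : i + 2 ≠ i := by clear * -; revert i; decide
  simp only [hx, n1, n2, if_true, if_false]
  have d0 : dl 0 = -1 := rfl
  have d1 : dl 1 = 0 := rfl
  have d2 : dl 2 = 1 := rfl
  have hA : exp (θ * (σ * (dl 0 : ℤ))) + exp (θ * (σ * (dl 1 : ℤ))) + exp (θ * (σ * (dl 2 : ℤ)))
      ≤ 3 * exp (θ ^ 2) := by
    have h := add_one_le_exp (θ ^ 2)
    rw [d0, d1, d2]
    rcases hσ with rfl | rfl <;> simp <;> nlinarith [sq_nonneg θ]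
  have hB : exp (2 * θ) + 2 * exp (-θ) ≤ 3 * exp (2 * θ ^ 2) := by
    have h := add_one_le_exp (2 * θ ^ 2)
    nlinarith [sq_nonneg θ]
  have hAB := mul_le_mul hA hB (by positivity) (by positivity)
  have hE : exp (3 * θ ^ 2) = exp (θ ^ 2) * exp (2 * θ ^ 2) := by rw [← exp_add]; ring_nf
  rw [hE]
  have hpos := (exp_pos (θ * (σ * p.2 + 3 * xc i p))).le
  have := mul_le_mul_of_nonneg_left hAB hpos
  generalize exp (θ * (σ * (dl 0 : ℤ))) = A0 at *
  generalize exp (θ * (σ * (dl 1 : ℤ))) = A1 at *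
  generalize exp (θ * (σ * (dl 2 : ℤ))) = A2 at *
  linarith

noncomputable def G (θ : ℝ) (p : St) : ℝ :=
  ∑ i : Fin 3, (exp (θ * (1 * p.2 + 3 * xc i p)) + exp (θ * ((-1) * p.2 + 3 * xc i p)))

lemma Q_G {θ : ℝ} (h0 : 0 ≤ θ) (h1 : θ ≤ 1/2) (p : St) : Q (G θ) p ≤ G θ p * exp (3 * θ ^ 2) := by
  have : Q (G θ) p = ∑ i : Fin 3, (Q (fun q => exp (θ * (1 * q.2 + 3 * xc i q))) p
      + Q (fun q => exp (θ * ((-1) * q.2 + 3 * xc i q))) p) := by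
    simp only [Q, G]
    rw [Finset.sum_comm, Finset.mul_sum]
    refine Finset.sum_congr rfl fun i _ => ?_
    rw [Finset.sum_add_distrib, mul_add]
  rw [this, G, Finset.sum_mul]
  refine Finset.sum_le_sum fun i _ => ?_
  rw [add_mul]
  exact add_le_add (Q_exp h0 h1 1 (Or.inl rfl) i p) (Q_exp h0 h1 (-1) (Or.inr rfl) i p)

lemma Q_mono {f g : St → ℝ} {p : St} (H : ∀ k, f (nx p k) ≤ g (nx p k)) : Q f p ≤ Q g p :=
  mul_le_mul_of_nonneg_left (Finset.sum_le_sum fun k _ => H k) (by norm_num)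

lemma exp_bound {n : ℕ} {θ : ℝ} (h0 : 0 ≤ θ) (h1 : θ ≤ 1/2) (j : ℕ) : ∀ p, R n j p →
    (K n)^[j] (fun q => exp (θ * |(q.2 : ℝ)|)) p ≤ G θ p * exp (3 * θ ^ 2 * j) := by
  have bdry : ∀ (j : ℕ) p, R n j p → ∀ c, p.1 c = n →
      (K n)^[j] (fun q => exp (θ * |(q.2 : ℝ)|)) p ≤ G θ p * exp (3 * θ ^ 2 * j) := by
    intro j p hp c hc
    refine (exp_crude h0 j p hp).trans ?_
    rw [← xc_bdry hp hc]
    have hG : exp (θ * (|(p.2 : ℝ)| + 3 * xc c p)) ≤ G θ p := by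
      rw [G]
      refine le_trans ?_ (Finset.single_le_sum (fun i _ => by positivity) (Finset.mem_univ c))
      rcases abs_cases (p.2 : ℝ) with ⟨h, -⟩ | ⟨h, -⟩ <;> rw [h]
      · rw [one_mul]; exact le_add_of_nonneg_right (exp_pos _).le
      · rw [neg_one_mul]; exact le_add_of_nonneg_left (exp_pos _).le
    refine hG.trans (le_mul_of_one_le_right ((exp_pos _).le.trans hG) (one_le_exp ?_))
    rw [xc_bdry hp hc]
    positivity
  induction j with
  | zero =>
    intro p hp
    refine bdry 0 p hp 0 ?_
    have := hp.2
    have h0 := hp.1 0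
    have h1 := hp.1 1
    have h2 := hp.1 2
    omega
  | succ j ih =>
    intro p hp
    by_cases h : ∃ c, p.1 c = n
    · obtain ⟨c, hc⟩ := h
      exact bdry _ p hp c hc
    push Not at h
    rw [Function.iterate_succ_apply', K_interior h]
    refine (Q_mono (g := fun p => G θ p * exp (3 * θ ^ 2 * j))
      (fun k => ih _ (hp.next (h k.1) k.2))).trans ?_
    have h2 : Q (fun p => G θ p * exp (3 * θ ^ 2 * j)) p = Q (G θ) p * exp (3 * θ ^ 2 * j) := by
      simp only [Q]; rw [← Finset.sum_mul]; ring
    rw [h2]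
    refine (mul_le_mul_of_nonneg_right (Q_G h0 h1 p) (exp_pos _).le).trans (le_of_eq ?_)
    rw [mul_assoc, ← exp_add]
    push_cast; ring_nf

abbrev E3 := EuclideanSpace ℝ (Fin 3)

/-- embedded state -/
noncomputable def Z (p : St) : E3 := !₂[(p.2 : ℝ), (p.1 0 : ℝ) - p.1 1, (p.1 1 : ℝ) - p.1 2]

noncomputable def ys (k : Fin 3 × Fin 3) : E3 := Z (nx (fun _ => 0, 0) k)

lemma Z_nx (p : St) (k : Fin 3 × Fin 3) : Z (nx p k) = Z p + ys k := by
  ext i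
  fin_cases i
  · simp [Z, ys, nx, e]
  · simp [Z, ys, nx, e]; ring
  · simp [Z, ys, nx, e]; ring

lemma Z_zero : Z (fun _ => 0, 0) = 0 := by
  ext i; fin_cases i <;> simp [Z]

noncomputable def Fn (x : E3) : ℝ := x 0 + max (x 1) (max (x 2) (-x 1 - x 2))

lemma Fn_Z (p : St) : Fn (Z p) = p.2 + F p := by
  simp [Fn, Z, F]

lemma Fn_cont : Continuous Fn := by
  unfold Fn; fun_prop

lemma Fn_smul {r : ℝ} (hr : 0 ≤ r) (x : E3) : Fn (r • x) = r * Fn x := by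
  simp only [Fn, PiLp.smul_apply, smul_eq_mul, mul_add]
  rw [mul_max_of_nonneg _ _ hr, mul_max_of_nonneg _ _ hr]
  congr 3
  ring

/-- law of the embedded free walk -/
noncomputable def nu : ℕ → Measure E3
  | 0 => Measure.dirac 0
  | m + 1 => ∑ k : Fin 3 × Fin 3, (1/9 : ℝ≥0∞) • (nu m).map (· + ys k)

lemma nu_prob (m : ℕ) : IsProbabilityMeasure (nu m) := by
  induction m with
  | zero => rw [nu]; infer_instance
  | succ m ih =>
    rw [nu]
    have : ∀ k, IsProbabilityMeasure ((nu m).map (· + ys k)) := fun k =>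
      Measure.isProbabilityMeasure_map (by fun_prop)
    constructor
    simp only [Measure.coe_finsetSum, Finset.sum_apply, Measure.smul_apply, measure_univ]
    simp [ENNReal.mul_inv_cancel]

instance (m : ℕ) : IsProbabilityMeasure (nu m) := nu_prob m

lemma integral_nu_succ {G : Type*} [NormedAddCommGroup G] [NormedSpace ℝ G] (f : E3 → G)
    (hf : Continuous f) [SecondCountableTopology G] {C : ℝ} (hC : ∀ x, ‖f x‖ ≤ C) (m : ℕ) :
    ∫ x, f x ∂(nu (m+1)) = ∑ k, (1/9 : ℝ) • ∫ x, f (x + ys k) ∂(nu m) := by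
  rw [nu, integral_finsetSum_measure]
  · refine Finset.sum_congr rfl fun k _ => ?_
    rw [integral_smul_measure, integral_map (by fun_prop) hf.aestronglyMeasurable]
    simp
  · intro k _
    have : IsProbabilityMeasure ((nu m).map (· + ys k)) :=
      Measure.isProbabilityMeasure_map (by fun_prop)
    refine Integrable.smul_measure ?_ (by simp)
    exact Integrable.of_bound hf.aestronglyMeasurable C (ae_of_all _ hC)

lemma Q_iter_eq (f : E3 → ℝ) (hf : Continuous f) {C : ℝ} (hC : ∀ x, ‖f x‖ ≤ C) (m : ℕ) :
    ∀ p, Q^[m] (fun q => f (Z q)) p = ∫ x, f (Z p + x) ∂(nu m) := by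
  induction m with
  | zero => intro p; simp [nu]
  | succ m ih =>
    intro p
    rw [Function.iterate_succ_apply', integral_nu_succ (fun x => f (Z p + x)) (by fun_prop)
      (fun x => hC _), Q, Finset.mul_sum]
    refine Finset.sum_congr rfl fun k _ => ?_
    rw [ih, Z_nx, smul_eq_mul]
    congr 1
    refine integral_congr_ae (ae_of_all _ fun x => ?_)
    simp only
    congr 1
    abel

noncomputable def chi (t : E3) : ℂ :=
  ∑ k, (1/9 : ℝ) • Complex.exp ((inner ℝ (ys k) t : ℝ) * Complex.I)

lemma charFun_nu (m : ℕ) (t : E3) : charFun (nu m) t = chi t ^ m := by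
  induction m with
  | zero => simp [nu]
  | succ m ih =>
    rw [charFun_apply, integral_nu_succ (fun x : E3 => Complex.exp ((inner ℝ x t : ℝ) * Complex.I))
      (by fun_prop) (C := 1) (fun x => by rw [Complex.norm_exp_ofReal_mul_I]), pow_succ, ← ih, chi,
      Finset.mul_sum]
    refine Finset.sum_congr rfl fun k _ => ?_
    rw [mul_smul_comm]
    congr 1
    rw [charFun_apply, ← integral_mul_const]
    refine integral_congr_ae (ae_of_all _ fun x => ?_)
    simp only [inner_add_left, Complex.ofReal_add, add_mul, Complex.exp_add]

lemma inner_ys (k : Fin 3 × Fin 3) (t : E3) : (inner ℝ (ys k) t : ℝ) =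
    (dl k.2) * t 0 + ((if k.1 = 0 then 1 else 0) - (if k.1 = 1 then 1 else 0)) * t 1
      + ((if k.1 = 1 then 1 else 0) - (if k.1 = 2 then 1 else 0)) * t 2 := by
  simp [ys, Z, nx, e, PiLp.inner_apply, Fin.sum_univ_three, eq_comm]
  ring

/-- quadratic form -/
noncomputable def qv (t : E3) : ℝ := 2/3 * (t 0 ^ 2 + t 1 ^ 2 + t 2 ^ 2 - t 1 * t 2)

lemma exp_littleO (r : ℝ) : (fun n : ℕ => Complex.exp ((((√n)⁻¹ * r : ℝ) : ℂ) * Complex.I)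
    - (1 + (((√n)⁻¹ * r : ℝ) : ℂ) * Complex.I - (r ^ 2 / 2 : ℂ) / n)) =o[atTop]
      fun n : ℕ => 1 / (n : ℂ) := by
  have hz : Tendsto (fun n : ℕ => (((√n)⁻¹ * r : ℝ) : ℂ) * Complex.I) atTop (𝓝 0) := by
    have h1 : Tendsto (fun n : ℕ => (√n)⁻¹ * r) atTop (𝓝 0) := by
      rw [← zero_mul r]
      exact .mul_const r (tendsto_inv_atTop_zero.comp <| Real.tendsto_sqrt_atTop.comp <|
        tendsto_natCast_atTop_atTop)
    have h2 := (Complex.continuous_ofReal.tendsto 0).comp h1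
    simpa using h2.mul_const Complex.I
  have h := (Complex.exp_sub_sum_range_succ_isLittleO_pow 2).comp_tendsto hz
  have hsq : ∀ n : ℕ, ((((√n)⁻¹ * r : ℝ) : ℂ) * Complex.I) ^ 2 = -(r ^ 2 : ℂ) / n := by
    intro n
    rw [mul_pow, Complex.I_sq, ← Complex.ofReal_pow, mul_pow, inv_pow, Real.sq_sqrt (by positivity)]
    push_cast; ring
  have h' : (fun n : ℕ => Complex.exp ((((√n)⁻¹ * r : ℝ) : ℂ) * Complex.I)
    - (1 + (((√n)⁻¹ * r : ℝ) : ℂ) * Complex.I - (r ^ 2 / 2 : ℂ) / n)) =o[atTop]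
      fun n : ℕ => (-(r ^ 2 : ℂ)) * (1 / (n : ℂ)) := by
    refine (h.congr (fun n => ?_) (fun n => ?_))
    · simp only [Function.comp, Finset.sum_range_succ, Finset.sum_range_zero, hsq]
      simp
      ring
    · simp only [Function.comp, hsq]
      ring
  exact h'.of_const_mul_right

lemma chi_tendsto (t : E3) :
    Tendsto (fun n : ℕ => chi ((√n)⁻¹ • t) ^ n) atTop (𝓝 (Complex.exp (-(qv t : ℂ) / 2))) := by
  apply Complex.tendsto_pow_exp_of_isLittleO_sub_add_div
  have h := Asymptotics.IsLittleO.sum (s := (Finset.univ : Finset (Fin 3 × Fin 3)))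
    (fun k _ => (exp_littleO (inner ℝ (ys k) t : ℝ)).const_mul_left (1/9 : ℂ))
  refine h.congr (fun n => ?_) (fun n => rfl)
  have h1 : ∑ k, (inner ℝ (ys k) t : ℝ) = 0 := by
    rw [sum9 0]; simp [inner_ys, dl]; ring
  have h2 : ∑ k, (inner ℝ (ys k) t : ℝ) ^ 2 = 9 * qv t := by
    rw [sum9 0]; simp [inner_ys, dl, qv]; ring
  have h1' : ∑ k, ((inner ℝ (ys k) t : ℝ) : ℂ) = 0 := by exact_mod_cast h1
  have h2' : ∑ k, ((inner ℝ (ys k) t : ℝ) : ℂ) ^ 2 = 9 * qv t := by exact_mod_cast h2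
  have h3 : ∀ k, (1/9 : ℂ) * (Complex.exp ((((√n)⁻¹ * (inner ℝ (ys k) t : ℝ) : ℝ) : ℂ) * Complex.I)
    - (1 + (((√n)⁻¹ * (inner ℝ (ys k) t : ℝ) : ℝ) : ℂ) * Complex.I
      - (((inner ℝ (ys k) t : ℝ) : ℂ) ^ 2 / 2 : ℂ) / n))
    = (1/9 : ℝ) • Complex.exp ((inner ℝ (ys k) ((√n)⁻¹ • t) : ℝ) * Complex.I) - 1/9
      - (1/9 * ((√n)⁻¹ : ℝ) * Complex.I) * ((inner ℝ (ys k) t : ℝ) : ℂ)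
      + (1/18 / n) * ((inner ℝ (ys k) t : ℝ) : ℂ) ^ 2 := by
    intro k
    rw [inner_smul_right, Complex.real_smul]
    push_cast
    ring
  simp only [Finset.sum_apply, h3]
  rw [Finset.sum_add_distrib, Finset.sum_sub_distrib, Finset.sum_sub_distrib, ← Finset.mul_sum,
    ← Finset.mul_sum, h1', h2', chi]
  simp
  ring

section limit
variable {Ω' : Type*} [MeasurableSpace Ω'] (P : Measure Ω') [IsProbabilityMeasure P]
    (W V1 V2 V3 : Ω' → ℝ)

lemma charFun_limit
    (hWm : Measurable W) (hV1 : Measurable V1) (hV2 : Measurable V2) (hV3 : Measurable V3)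
    (hW : P.map W = gaussianReal 0 2)
    (hV : ∀ a b c : ℝ, P.map (fun ω => a * V1 ω + b * V2 ω + c * V3 ω)
        = gaussianReal 0 (Real.toNNReal
            (2 / 3 * (a ^ 2 + b ^ 2 + c ^ 2) - 2 / 3 * (a * b + a * c + b * c))))
    (hindep : IndepFun W (fun ω => (V1 ω, V2 ω, V3 ω)) P) (t : E3) :
    charFun (P.map (fun ω => (!₂[W ω, V1 ω - V2 ω, V2 ω - V3 ω] : E3))) t
      = Complex.exp (-(qv t : ℂ) / 2) ^ 3 := by
  have hm : Measurable (fun ω => (!₂[W ω, V1 ω - V2 ω, V2 ω - V3 ω] : E3)) := by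
    refine (PiLp.continuous_toLp 2 _).measurable.comp (measurable_pi_iff.2 fun i => ?_)
    fin_cases i
    · exact hWm
    · exact hV1.sub hV2
    · exact hV2.sub hV3
  set Y : Ω' → ℝ := fun ω => t 1 * V1 ω + (t 2 - t 1) * V2 ω + (- t 2) * V3 ω
  have hYm : Measurable Y := by fun_prop
  have hi : IndepFun (fun ω => t 0 * W ω) Y P :=
    hindep.comp (φ := fun w => t 0 * w)
      (ψ := fun v : ℝ × ℝ × ℝ => t 1 * v.1 + (t 2 - t 1) * v.2.1 + (- t 2) * v.2.2)
      (by fun_prop) (by fun_prop)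
  have h1 : charFun (P.map (fun ω => (!₂[W ω, V1 ω - V2 ω, V2 ω - V3 ω] : E3))) t
      = charFun (P.map (fun ω => t 0 * W ω + Y ω)) 1 := by
    rw [charFun_apply, charFun_apply, integral_map hm.aemeasurable (by fun_prop),
      integral_map (by fun_prop) (by fun_prop)]
    refine integral_congr_ae (ae_of_all _ fun ω => ?_)
    simp [PiLp.inner_apply, Fin.sum_univ_three, Y]
    congr 1
    ring
  rw [h1, hi.charFun_map_fun_add_eq_mul (by fun_prop) (by fun_prop), Pi.mul_apply,
    charFun_map_mul_comp (by fun_prop), hW, hV, charFun_gaussianReal, charFun_gaussianReal,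
    ← Complex.exp_add, ← Complex.exp_nat_mul]
  congr 1
  rw [Real.coe_toNNReal _ (by nlinarith [sq_nonneg (t 1), sq_nonneg (t 2), sq_nonneg (t 1 - t 2)])]
  simp [qv]
  ring

lemma free_clt
    (hWm : Measurable W) (hV1 : Measurable V1) (hV2 : Measurable V2) (hV3 : Measurable V3)
    (hW : P.map W = gaussianReal 0 2)
    (hV : ∀ a b c : ℝ, P.map (fun ω => a * V1 ω + b * V2 ω + c * V3 ω)
        = gaussianReal 0 (Real.toNNReal
            (2 / 3 * (a ^ 2 + b ^ 2 + c ^ 2) - 2 / 3 * (a * b + a * c + b * c))))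
    (hindep : IndepFun W (fun ω => (V1 ω, V2 ω, V3 ω)) P)
    (g : ℝ → ℝ) (hg : Continuous g) {C : ℝ} (hC : ∀ x, ‖g x‖ ≤ C) :
    Tendsto (fun n : ℕ => Q^[3 * n] (fun q => g ((√n)⁻¹ * (q.2 + F q))) (fun _ => 0, 0)) atTop
      (𝓝 (∫ ω, g (W ω + max (V1 ω + 2 * V2 ω)
              (max (V2 ω + 2 * V3 ω) (V3 ω + 2 * V1 ω))) ∂P)) := by
  have hm : Measurable (fun ω => (!₂[W ω, V1 ω - V2 ω, V2 ω - V3 ω] : E3)) := by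
    refine (PiLp.continuous_toLp 2 _).measurable.comp (measurable_pi_iff.2 fun i => ?_)
    fin_cases i
    · exact hWm
    · exact hV1.sub hV2
    · exact hV2.sub hV3
  have i1 : ∀ n : ℕ, IsProbabilityMeasure ((nu (3 * n)).map ((√n)⁻¹ • ·)) := fun n =>
    Measure.isProbabilityMeasure_map (by fun_prop)
  have i2 : IsProbabilityMeasure (P.map (fun ω => (!₂[W ω, V1 ω - V2 ω, V2 ω - V3 ω] : E3))) :=
    Measure.isProbabilityMeasure_map hm.aemeasurable
  let m : ℕ → ProbabilityMeasure E3 := fun n => ⟨(nu (3 * n)).map ((√n)⁻¹ • ·), i1 n⟩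
  let m0 : ProbabilityMeasure E3 :=
    ⟨P.map (fun ω => (!₂[W ω, V1 ω - V2 ω, V2 ω - V3 ω] : E3)), i2⟩
  have hconv : Tendsto m atTop (𝓝 m0) := by
    refine ProbabilityMeasure.tendsto_of_tendsto_charFun fun t => ?_
    simp only [m, m0, ProbabilityMeasure.coe_mk]
    rw [charFun_limit P W V1 V2 V3 hWm hV1 hV2 hV3 hW hV hindep]
    refine ((chi_tendsto t).pow 3).congr fun n => ?_
    rw [charFun_map_smul, charFun_nu, ← pow_mul, mul_comm n]
  have h := ProbabilityMeasure.tendsto_iff_forall_integral_tendsto.1 hconv (BoundedContinuousFunction.ofNormedAddCommGroup (fun x => g (Fn x))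
    (hg.comp Fn_cont) C (fun x => hC _))
  simp only [m, m0, ProbabilityMeasure.coe_mk, BoundedContinuousFunction.coe_ofNormedAddCommGroup] at h
  have hgF : Continuous (fun x => g (Fn x)) := hg.comp Fn_cont
  have hzero : ∀ᵐ ω ∂P, V1 ω + V2 ω + V3 ω = 0 := by
    have h0 := hV 1 1 1
    norm_num at h0
    have : ∀ᵐ x ∂(P.map (fun ω => V1 ω + V2 ω + V3 ω)), x = 0 := by
      rw [h0]; simp [ae_dirac_eq]
    exact ae_of_ae_map (by fun_prop) this
  have hlim : ∫ x, g (Fn x) ∂(P.map (fun ω => (!₂[W ω, V1 ω - V2 ω, V2 ω - V3 ω] : E3)))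
      = ∫ ω, g (W ω + max (V1 ω + 2 * V2 ω)
              (max (V2 ω + 2 * V3 ω) (V3 ω + 2 * V1 ω))) ∂P := by
    rw [integral_map hm.aemeasurable hgF.aestronglyMeasurable]
    refine integral_congr_ae ?_
    filter_upwards [hzero] with ω hω
    have hV3 : V3 ω = - V1 ω - V2 ω := by linarith
    simp only [Fn]
    simp
    rw [hV3]
    congr 2
    rw [max_comm, max_assoc]
    congr 1
    · ring
    · congr 1 <;> ring
  rw [hlim] at h
  refine h.congr fun n => ?_
  rw [integral_map (by fun_prop) hgF.aestronglyMeasurable]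
  have := Q_iter_eq (fun x => g (Fn ((√n)⁻¹ • x))) (by
    exact hgF.comp (continuous_const_smul _)) (fun x => hC _) (3 * n) (fun _ => 0, 0)
  rw [Z_zero] at this
  simp only [zero_add] at this
  rw [← this]
  have hf : (fun q : St => g (Fn ((√n)⁻¹ • Z q))) = fun q => g ((√n)⁻¹ * (q.2 + F q)) := by
    funext q
    rw [Fn_smul (by positivity), Fn_Z]
  rw [hf]

end limit

lemma R_zero (n : ℕ) : R n (3 * n) (fun _ => 0, 0) := by
  constructor <;> simp

lemma Dd_zero : Dd (fun _ => 0, 0) = 0 := by simp [Dd, xc]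

lemma G_zero (θ : ℝ) : G θ (fun _ => 0, 0) = 6 := by simp [G, xc]; norm_num

lemma err_bound {n : ℕ} {Ω : Type*} [MeasurableSpace Ω] {μ : Measure Ω}
    {NS : ℕ → Ω → (Fin 3 → ℕ) × ℤ} (h : IsGreedyProcess n μ NS) (hn : 1 ≤ n)
    {g : ℝ → ℝ} {C : ℝ} (hC : 0 ≤ C) (hg : ∀ x y, |g x - g y| ≤ C * |x - y|) :
    |∫ ω, g (((NS (3 * n) ω).2 : ℝ) / √n) ∂μ
      - Q^[3 * n] (fun q => g ((√n)⁻¹ * (q.2 + F q))) (fun _ => 0, 0)| ≤ 36 * C / √(√n) := by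
  have hn' : (0 : ℝ) < n := by exact_mod_cast hn
  have hs : 0 < √(n : ℝ) := Real.sqrt_pos.2 hn'
  have he : 0 < √(√(n : ℝ)) := Real.sqrt_pos.2 hs
  have h1 := (integral_iter h le_rfl (fun q => g ((√n)⁻¹ * q.2))).2
  have h2 : ∀ ω, ((NS (3 * n) ω).2 : ℝ) / √n = (√n)⁻¹ * (NS (3 * n) ω).2 := by
    intro ω; rw [div_eq_inv_mul]
  simp only [h2]
  rw [h1]
  have h3 := compare (n := n) (φ := fun x => g ((√n)⁻¹ * x)) (L := C * (√n)⁻¹) (by positivity)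
    (fun x y => by
      refine (hg _ _).trans (le_of_eq ?_)
      rw [← mul_sub, abs_mul, abs_of_pos (inv_pos.2 hs), mul_assoc]) he hs (3 * n) _ (R_zero n)
  refine h3.trans ?_
  rw [Dd_zero]
  push_cast
  have e1 : √(n : ℝ) = √(√(n : ℝ)) ^ 2 := (Real.sq_sqrt hs.le).symm
  have e2 : (n : ℝ) = √(√(n : ℝ)) ^ 4 := by
    rw [show 4 = 2 * 2 by norm_num, pow_mul, Real.sq_sqrt hs.le, Real.sq_sqrt hn'.le]
  generalize √(√(n : ℝ)) = r at *
  rw [e1, e2]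
  have : C * (r ^ 2)⁻¹ * (r + (11/3) / r * ((r ^ 2 + (9 * 0 + 6 * (3 * r ^ 4)) / r ^ 2) / 2))
      = (1 + 11/6 * 19) * C / r := by
    field_simp
    ring
  rw [this]
  gcongr
  norm_num

lemma exp_moment {n : ℕ} {Ω : Type*} [MeasurableSpace Ω] {μ : Measure Ω}
    {NS : ℕ → Ω → (Fin 3 → ℕ) × ℤ} (h : IsGreedyProcess n μ NS) (hn : 4 ≤ n) :
    Integrable (fun ω => exp |((NS (3 * n) ω).2 : ℝ) / √n|) μ ∧
    ∫ ω, exp |((NS (3 * n) ω).2 : ℝ) / √n| ∂μ ≤ 6 * exp 9 := by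
  have hn' : (4 : ℝ) ≤ n := by exact_mod_cast hn
  have hs : 2 ≤ √(n : ℝ) := Real.le_sqrt_of_sq_le (by norm_num; exact hn)
  have hs0 : 0 < √(n : ℝ) := by linarith
  have h2 : ∀ ω, |((NS (3 * n) ω).2 : ℝ) / √n| = (√n)⁻¹ * |((NS (3 * n) ω).2 : ℝ)| := by
    intro ω; rw [div_eq_inv_mul, abs_mul, abs_of_pos (inv_pos.2 hs0)]
  simp only [h2]
  have h1 := integral_iter h le_rfl (fun q => exp ((√n)⁻¹ * |(q.2 : ℝ)|))
  refine ⟨h1.1, ?_⟩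
  rw [h1.2]
  have h3 := exp_bound (n := n) (θ := (√n)⁻¹) (by positivity)
    (by rw [inv_le_comm₀ hs0 (by norm_num)]; norm_num; exact hs) (3 * n) _ (R_zero n)
  refine h3.trans (le_of_eq ?_)
  rw [G_zero, inv_pow, Real.sq_sqrt (by linarith)]
  congr 2
  push_cast
  field_simp
  norm_num

lemma clip_bound {M : ℝ} (hM : 0 < M) (k : ℕ) (x : ℝ) :
    |x ^ k - (max (min x M) (-M)) ^ k| ≤ 2 * |x| ^ (k + 1) / M := by
  rcases le_or_gt |x| M with h | h
  · have := abs_le.1 h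
    rw [min_eq_left this.2, max_eq_left this.1, sub_self, abs_zero]
    positivity
  · have hc : |max (min x M) (-M)| ≤ M := by
      rw [abs_le]
      exact ⟨le_max_right _ _, max_le (min_le_right _ _) (by linarith)⟩
    rw [le_div_iff₀ hM]
    have h1 : |x ^ k - (max (min x M) (-M)) ^ k| ≤ |x| ^ k + |x| ^ k := by
      refine (abs_sub _ _).trans ?_
      rw [abs_pow, abs_pow]
      exact add_le_add le_rfl (pow_le_pow_left₀ (abs_nonneg _) (hc.trans h.le) k)
    calc _ ≤ (|x| ^ k + |x| ^ k) * |x| := by gcongr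
      _ = _ := by ring

lemma pow_abs_le_exp (k : ℕ) (x : ℝ) : |x| ^ k ≤ k.factorial * exp |x| := by
  have := Real.pow_div_factorial_le_exp |x| (abs_nonneg x) k
  rw [div_le_iff₀ (by positivity)] at this
  linarith

noncomputable def clipB (M : ℝ) (hM : 0 < M) (k : ℕ) : BoundedContinuousFunction ℝ ℝ :=
  BoundedContinuousFunction.ofNormedAddCommGroup (fun x => (max (min x M) (-M)) ^ k)
    (by fun_prop) (M ^ k) (fun x => by
      rw [norm_pow]
      gcongr
      rw [Real.norm_eq_abs, abs_le]
      exact ⟨le_max_right _ _, max_le (min_le_right _ _) (by linarith)⟩)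

lemma clip_int {Ω : Type*} [MeasurableSpace Ω] {μ : Measure Ω} [IsProbabilityMeasure μ]
    {X : Ω → ℝ} (hX : Measurable X) {M : ℝ} (hM : 0 < M) {k : ℕ}
    (h1 : Integrable (fun ω => X ω ^ k) μ) (h2 : Integrable (fun ω => |X ω| ^ (k + 1)) μ)
    {A : ℝ} (hA : ∫ ω, |X ω| ^ (k + 1) ∂μ ≤ A) :
    |∫ ω, X ω ^ k ∂μ - ∫ ω, clipB M hM k (X ω) ∂μ| ≤ 2 * A / M := by
  have h3 : Integrable (fun ω => clipB M hM k (X ω)) μ :=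
    Integrable.of_bound ((clipB M hM k).continuous.measurable.comp hX).aestronglyMeasurable
      ‖clipB M hM k‖ (ae_of_all _ fun ω => (clipB M hM k).norm_coe_le_norm _)
  rw [← integral_sub h1 h3]
  refine (abs_integral_le_integral_abs).trans ?_
  calc _ ≤ ∫ ω, 2 / M * |X ω| ^ (k + 1) ∂μ := by
        refine integral_mono (h1.sub h3).abs (h2.const_mul _) fun ω => ?_
        refine (clip_bound hM k (X ω)).trans (le_of_eq ?_)
        ring
    _ = 2 / M * ∫ ω, |X ω| ^ (k + 1) ∂μ := integral_const_mul _ _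
    _ ≤ 2 / M * A := by gcongr
    _ = _ := by ring

lemma moments_tendsto (Ω : ℕ → Type*) [∀ n, MeasurableSpace (Ω n)] (μ : ∀ n, Measure (Ω n))
    (X : ∀ n, Ω n → ℝ) {C : ℝ}
    (hX : ∀ᶠ n in atTop, IsProbabilityMeasure (μ n) ∧ Measurable (X n) ∧
      Integrable (fun ω => exp |X n ω|) (μ n) ∧ ∫ ω, exp |X n ω| ∂(μ n) ≤ C)
    {Ω' : Type*} [MeasurableSpace Ω'] (P : Measure Ω') [IsProbabilityMeasure P]
    (Y : Ω' → ℝ) (hY : Measurable Y) (hYi : ∀ k : ℕ, Integrable (fun ω => |Y ω| ^ k) P)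
    (hconv : ∀ g : BoundedContinuousFunction ℝ ℝ,
      Tendsto (fun n => ∫ ω, g (X n ω) ∂(μ n)) atTop (𝓝 (∫ ω, g (Y ω) ∂P))) (k : ℕ) :
    Tendsto (fun n => ∫ ω, X n ω ^ k ∂(μ n)) atTop (𝓝 (∫ ω, Y ω ^ k ∂P)) := by
  rw [Metric.tendsto_nhds]
  intro ε hε
  set A : ℝ := max ((k + 1).factorial * C) (∫ ω, |Y ω| ^ (k + 1) ∂P) with hAdef
  have hA : 0 ≤ A := le_max_of_le_right (integral_nonneg fun ω => by positivity)
  set M : ℝ := 6 * (A + 1) / ε with hMdef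
  have hM : 0 < M := by positivity
  have hAM : 2 * A / M < ε / 3 := by
    rw [hMdef]
    rw [div_lt_iff₀ (by positivity)]
    field_simp
    linarith
  filter_upwards [hX, Metric.tendsto_nhds.1 (hconv (clipB M hM k)) (ε / 3) (by positivity)]
    with n ⟨i, hm, hi, hb⟩ h2
  have hp : ∀ j : ℕ, Integrable (fun ω => |X n ω| ^ j) (μ n) := fun j =>
    Integrable.mono' (hi.const_mul (j.factorial : ℝ)) (by fun_prop)
      (ae_of_all _ fun ω => by
        rw [Real.norm_eq_abs, abs_of_nonneg (by positivity)]; exact pow_abs_le_exp j _)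
  have hp' : Integrable (fun ω => X n ω ^ k) (μ n) :=
    (hp k).mono' (by fun_prop) (ae_of_all _ fun ω => by
      rw [Real.norm_eq_abs, abs_pow])
  have hYk : Integrable (fun ω => Y ω ^ k) P :=
    (hYi k).mono' (by fun_prop) (ae_of_all _ fun ω => by
      rw [Real.norm_eq_abs, abs_pow])
  have hbA : ∫ ω, |X n ω| ^ (k + 1) ∂(μ n) ≤ A := by
    refine le_max_of_le_left ?_
    calc _ ≤ ∫ ω, ((k + 1).factorial : ℝ) * exp |X n ω| ∂(μ n) :=
          integral_mono (hp _) (hi.const_mul _) fun ω => pow_abs_le_exp _ _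
      _ = (k + 1).factorial * ∫ ω, exp |X n ω| ∂(μ n) := integral_const_mul _ _
      _ ≤ _ := by gcongr
  have t1 := clip_int hm hM hp' (hp _) hbA
  have t2 := clip_int hY hM hYk (hYi _) (le_max_right _ _ : _ ≤ A)
  rw [Real.dist_eq] at h2 ⊢
  rw [abs_le] at t1 t2
  rw [abs_lt] at h2 ⊢
  constructor <;> linarith [t1.1, t1.2, t2.1, t2.2, h2.1, h2.2]

lemma weak_conv (Ω : ℕ → Type*) [∀ n, MeasurableSpace (Ω n)] (μ : ∀ n, Measure (Ω n))
    (X : ∀ n, Ω n → ℝ) (hX : ∀ n, 1 ≤ n → IsProbabilityMeasure (μ n) ∧ Measurable (X n))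
    {Ω' : Type*} [MeasurableSpace Ω'] (P : Measure Ω') [IsProbabilityMeasure P]
    (Y : Ω' → ℝ) (hY : Measurable Y)
    (hl : ∀ (g : ℝ → ℝ) (C D : ℝ), 0 ≤ C → (∀ x y, |g x - g y| ≤ C * |x - y|) →
      (∀ x, ‖g x‖ ≤ D) →
      Tendsto (fun n => ∫ ω, g (X n ω) ∂(μ n)) atTop (𝓝 (∫ ω, g (Y ω) ∂P)))
    (g : BoundedContinuousFunction ℝ ℝ) :
      Tendsto (fun n => ∫ ω, g (X n ω) ∂(μ n)) atTop (𝓝 (∫ ω, g (Y ω) ∂P)) := by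
  have i1 : ∀ n, IsProbabilityMeasure ((μ (n + 1)).map (X (n + 1))) := fun n =>
    haveI := (hX (n + 1) (by omega)).1
    Measure.isProbabilityMeasure_map (hX (n + 1) (by omega)).2.aemeasurable
  have i2 : IsProbabilityMeasure (P.map Y) := Measure.isProbabilityMeasure_map hY.aemeasurable
  let m : ℕ → ProbabilityMeasure ℝ := fun n => ⟨(μ (n + 1)).map (X (n + 1)), i1 n⟩
  let m0 : ProbabilityMeasure ℝ := ⟨P.map Y, i2⟩
  have hm : ∀ (f : ℝ → ℝ), Continuous f → ∀ n, ∫ x, f x ∂(m n : Measure ℝ)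
      = ∫ ω, f (X (n + 1) ω) ∂(μ (n + 1)) := by
    intro f hf n
    exact integral_map (hX (n + 1) (by omega)).2.aemeasurable hf.aestronglyMeasurable
  have hm0 : ∀ (f : ℝ → ℝ), Continuous f → ∫ x, f x ∂(m0 : Measure ℝ) = ∫ ω, f (Y ω) ∂P :=
    fun f hf => integral_map hY.aemeasurable hf.aestronglyMeasurable
  have hconv : Tendsto m atTop (𝓝 m0) := by
    rw [tendsto_iff_forall_lipschitz_integral_tendsto]
    rintro f ⟨D, hD⟩ ⟨C, hC⟩
    simp only [hm f hC.continuous, hm0 f hC.continuous]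
    refine (tendsto_add_atTop_iff_nat (f := fun n => ∫ ω, f (X n ω) ∂(μ n)) 1).2 ?_
    refine hl f C (|f 0| + D) C.2 (fun x y => ?_) (fun x => ?_)
    · have := hC.dist_le_mul x y
      rwa [Real.dist_eq, Real.dist_eq] at this
    · have := hD x 0
      rw [Real.dist_eq] at this
      rw [Real.norm_eq_abs]
      have h := abs_add_le (f x - f 0) (f 0)
      rw [sub_add_cancel] at h
      linarith
  have h := ProbabilityMeasure.tendsto_iff_forall_integral_tendsto.1 hconv g
  simp only [hm g g.continuous, hm0 g g.continuous] at h
  exact (tendsto_add_atTop_iff_nat (f := fun n => ∫ ω, g (X n ω) ∂(μ n)) 1).1 h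

lemma limit_moments {Ω' : Type*} [MeasurableSpace Ω'] (P : Measure Ω') [IsProbabilityMeasure P]
    (W V1 V2 V3 : Ω' → ℝ)
    (hWm : Measurable W) (hV1 : Measurable V1) (hV2 : Measurable V2) (hV3 : Measurable V3)
    (hW : P.map W = gaussianReal 0 2)
    (hV : ∀ a b c : ℝ, P.map (fun ω => a * V1 ω + b * V2 ω + c * V3 ω)
        = gaussianReal 0 (Real.toNNReal
            (2 / 3 * (a ^ 2 + b ^ 2 + c ^ 2) - 2 / 3 * (a * b + a * c + b * c)))) (k : ℕ) :
    Integrable (fun ω => |W ω + max (V1 ω + 2 * V2 ω)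
              (max (V2 ω + 2 * V3 ω) (V3 ω + 2 * V1 ω))| ^ k) P := by
  have gen : ∀ (X : Ω' → ℝ) (v : NNReal), Measurable X → P.map X = gaussianReal 0 v →
      MemLp X (k : ℝ≥0∞) P := by
    intro X v hX hv
    have := memLp_id_gaussianReal' (μ := 0) (v := v) (k : ℝ≥0∞) (by simp)
    rw [← hv, memLp_map_measure_iff (by fun_prop) hX.aemeasurable] at this
    exact this
  have a := gen W _ hWm hW
  have b1 := gen _ _ (by fun_prop) (hV 1 2 0)
  have b2 := gen _ _ (by fun_prop) (hV 0 1 2)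
  have b3 := gen _ _ (by fun_prop) (hV 2 0 1)
  have hm := a.add (b1.sup (b2.sup b3))
  have := hm.integrable_norm_pow'
  refine this.congr (ae_of_all _ fun ω => ?_)
  simp only [Real.norm_eq_abs, Pi.add_apply, Pi.sup_apply]
  congr 2
  rw [show V3 ω + 2 * V1 ω = 2 * V1 ω + V3 ω by ring]
  simp

/-- Theorem TL2: `n^{-1/2} S_n^gr` converges in distribution, with all
moments, to `𝒮 = W + max(V₁+2V₂, V₂+2V₃, V₃+2V₁)` where `W ∼ N(0,2)` is independent of the
centered Gaussian vector `(V₁,V₂,V₃)` with covariances `2/3` on and `−1/3` off the diagonal. -/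
theorem greedy_score_clt
    (Ω : ℕ → Type*) [∀ n, MeasurableSpace (Ω n)] (μ : ∀ n, Measure (Ω n))
    (NS : ∀ n, ℕ → Ω n → (Fin 3 → ℕ) × ℤ)
    (hproc : ∀ n, 1 ≤ n → IsGreedyProcess n (μ n) (NS n))
    {Ω' : Type*} [MeasurableSpace Ω'] (P : Measure Ω') [IsProbabilityMeasure P]
    (W V1 V2 V3 : Ω' → ℝ)
    (hWm : Measurable W) (hV1 : Measurable V1) (hV2 : Measurable V2) (hV3 : Measurable V3)
    (hW : P.map W = gaussianReal 0 2)
    (hV : ∀ a b c : ℝ, P.map (fun ω => a * V1 ω + b * V2 ω + c * V3 ω)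
        = gaussianReal 0 (Real.toNNReal
            (2 / 3 * (a ^ 2 + b ^ 2 + c ^ 2) - 2 / 3 * (a * b + a * c + b * c))))
    (hindep : IndepFun W (fun ω => (V1 ω, V2 ω, V3 ω)) P) :
    (∀ g : BoundedContinuousFunction ℝ ℝ,
        Tendsto (fun n : ℕ =>
            ∫ ω, g (((NS n (3 * n) ω).2 : ℝ) / Real.sqrt n) ∂(μ n))
          atTop
          (𝓝 (∫ ω, g (W ω + max (V1 ω + 2 * V2 ω)
              (max (V2 ω + 2 * V3 ω) (V3 ω + 2 * V1 ω))) ∂P))) ∧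
    (∀ k : ℕ, 0 < k →
        Tendsto (fun n : ℕ =>
            ∫ ω, (((NS n (3 * n) ω).2 : ℝ) / Real.sqrt n) ^ k ∂(μ n))
          atTop
          (𝓝 (∫ ω, (W ω + max (V1 ω + 2 * V2 ω)
              (max (V2 ω + 2 * V3 ω) (V3 ω + 2 * V1 ω))) ^ k ∂P))) := by
  have hlip : ∀ (g : ℝ → ℝ) (C D : ℝ), 0 ≤ C → (∀ x y, |g x - g y| ≤ C * |x - y|) →
      (∀ x, ‖g x‖ ≤ D) →
      Tendsto (fun n : ℕ => ∫ ω, g (((NS n (3 * n) ω).2 : ℝ) / Real.sqrt n) ∂(μ n)) atTop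
        (𝓝 (∫ ω, g (W ω + max (V1 ω + 2 * V2 ω)
              (max (V2 ω + 2 * V3 ω) (V3 ω + 2 * V1 ω))) ∂P)) := by
    intro g C D hC hg hD
    have hgc : Continuous g := by
      refine (LipschitzWith.of_dist_le_mul (K := ⟨C, hC⟩) fun x y => ?_).continuous
      rw [Real.dist_eq, Real.dist_eq]
      exact hg x y
    have h1 := free_clt P W V1 V2 V3 hWm hV1 hV2 hV3 hW hV hindep g hgc hD
    have h2 : Tendsto (fun n : ℕ => 36 * C / √(√(n : ℝ))) atTop (𝓝 0) :=
      tendsto_const_nhds.div_atTop (Real.tendsto_sqrt_atTop.comp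
        (Real.tendsto_sqrt_atTop.comp tendsto_natCast_atTop_atTop))
    have h3 : Tendsto (fun n : ℕ => ∫ ω, g (((NS n (3 * n) ω).2 : ℝ) / √n) ∂(μ n)
      - Q^[3 * n] (fun q => g ((√n)⁻¹ * (q.2 + F q))) (fun _ => 0, 0)) atTop (𝓝 0) := by
      refine squeeze_zero_norm' ?_ h2
      filter_upwards [eventually_ge_atTop 1] with n hn
      exact err_bound (hproc n hn) hn hC hg
    have h4 := h3.add h1
    simpa using h4
  have hmeas : ∀ n, 1 ≤ n →
      Measurable (fun ω => ((NS n (3 * n) ω).2 : ℝ) / Real.sqrt n) := by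
    intro n hn
    have h1 := (hproc n hn).2.1 (3 * n)
    exact (measurable_of_countable (fun p : St => (p.2 : ℝ) / Real.sqrt n)).comp h1
  have hY : Measurable (fun ω => W ω + max (V1 ω + 2 * V2 ω)
      (max (V2 ω + 2 * V3 ω) (V3 ω + 2 * V1 ω))) := by fun_prop
  have hweak := weak_conv Ω μ (fun n ω => ((NS n (3 * n) ω).2 : ℝ) / Real.sqrt n)
    (fun n hn => ⟨(hproc n hn).1, hmeas n hn⟩) P _ hY hlip
  refine ⟨hweak, fun k _ => ?_⟩
  refine moments_tendsto Ω μ (fun n ω => ((NS n (3 * n) ω).2 : ℝ) / Real.sqrt n)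
    (C := 6 * exp 9) ?_ P _ hY
    (limit_moments P W V1 V2 V3 hWm hV1 hV2 hV3 hW hV) hweak k
  filter_upwards [eventually_ge_atTop 4] with n hn
  have h := hproc n (by omega)
  exact ⟨h.1, hmeas n (by omega), exp_moment h hn⟩

end RPSGreedy
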